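/- Algebraic identity characterization of Krull dimension (Lombardi): let A be a commutative ring and ℓ a natural number. Then ringKrullDim A ≤ ℓ if and only if for all x₀, …, x_ℓ ∈ A there exist a₀, …, a_ℓ ∈ A and natural numbers m₀, …, m_ℓ such that r₀ = 0, where r_ℓ := x_ℓ^{m_ℓ} · (1 + a_ℓ·x_ℓ) and r_i := x_i^{m_i} · (r_{i+1} + a_i·x_i) for 0 ≤ i < ℓ; i.e. x₀^{m₀}·(x₁^{m₁}·(⋯(x_ℓ^{m_ℓ}·(1 + a_ℓ x_ℓ) + ⋯ + a₁ x₁) + a₀ x₀) = 0. [Corollary 4.4.5, equivalence of (1) and (3)] -/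

import Mathlib

/-- `lombardiChain x a m ℓ k` is `r_{ℓ - k}` where
`r_ℓ = x_ℓ ^ m_ℓ * (1 + a_ℓ * x_ℓ)` and
`r_i = x_i ^ m_i * (r_{i+1} + a_i * x_i)` for `i < ℓ`. -/
def lombardiChain {A : Type*} [CommRing A] (x a : ℕ → A) (m : ℕ → ℕ) (ℓ : ℕ) : ℕ → A
  | 0 => x ℓ ^ m ℓ * (1 + a ℓ * x ℓ)
  | k + 1 => x (ℓ - (k + 1)) ^ m (ℓ - (k + 1)) *
      (lombardiChain x a m ℓ k + a (ℓ - (k + 1)) * x (ℓ - (k + 1)))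

/-- The submonoid of elements `x ^ m * (s + a * x)` with `s ∈ S`. -/
def Submonoid.lombardiStep {A : Type*} [CommRing A] (S : Submonoid A) (x : A) : Submonoid A where
  carrier := {r | ∃ s ∈ S, ∃ (a : A) (m : ℕ), r = x ^ m * (s + a * x)}
  one_mem' := ⟨1, S.one_mem, 0, 0, by simp⟩
  mul_mem' := by
    rintro _ _ ⟨s, hs, a, m, rfl⟩ ⟨t, ht, b, n, rfl⟩
    exact ⟨s * t, S.mul_mem hs ht, s * b + a * t + a * b * x, m + n, by ring⟩

/-- The iterated boundary submonoid of `x_ℓ, …, x_{ℓ - k}`: the values of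
`lombardiChain x a m ℓ k` when `k ≤ ℓ`. -/
def lombardiSubmonoid {A : Type*} [CommRing A] (x : ℕ → A) (ℓ : ℕ) : ℕ → Submonoid A
  | 0 => (⊥ : Submonoid A).lombardiStep (x ℓ)
  | k + 1 => (lombardiSubmonoid x ℓ k).lombardiStep (x (ℓ - (k + 1)))

theorem lombardiChain_congr {A : Type*} [CommRing A] {x a b : ℕ → A} {m n : ℕ → ℕ} {ℓ k : ℕ}
    (hab : ∀ i, ℓ - k ≤ i → a i = b i) (hmn : ∀ i, ℓ - k ≤ i → m i = n i) :
    lombardiChain x a m ℓ k = lombardiChain x b n ℓ k := by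
  induction k with
  | zero => simp only [lombardiChain, hab ℓ (by simp), hmn ℓ (by simp)]
  | succ k ih =>
    simp only [lombardiChain, hab _ le_rfl, hmn _ le_rfl]
    rw [ih (fun i hi ↦ hab i (by omega)) (fun i hi ↦ hmn i (by omega))]

theorem exists_lombardiChain_eq {A : Type*} [CommRing A] {x : ℕ → A} {ℓ k : ℕ} (hk : k ≤ ℓ)
    {r : A} (hr : r ∈ lombardiSubmonoid x ℓ k) :
    ∃ (a : ℕ → A) (m : ℕ → ℕ), lombardiChain x a m ℓ k = r := by
  induction k generalizing r with
  | zero =>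
    obtain ⟨s, hs, a, m, rfl⟩ := hr
    rw [Submonoid.mem_bot.mp hs]
    exact ⟨fun _ ↦ a, fun _ ↦ m, rfl⟩
  | succ k ih =>
    obtain ⟨s, hs, c, n, rfl⟩ := hr
    obtain ⟨a, m, rfl⟩ := ih (by omega) hs
    refine ⟨Function.update a (ℓ - (k + 1)) c, Function.update m (ℓ - (k + 1)) n, ?_⟩
    simp only [lombardiChain, Function.update_self]
    rw [lombardiChain_congr (b := a) (n := m)] <;>
    · intro i hi
      exact Function.update_of_ne (by omega) _ _

theorem PrimeSpectrum.exists_gt_disjoint_of_disjoint_lombardiStep {A : Type*} [CommRing A]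
    {S : Submonoid A} {x : A} {P : PrimeSpectrum A}
    (hP : Disjoint (P.asIdeal : Set A) (S.lombardiStep x)) :
    ∃ Q : PrimeSpectrum A, P < Q ∧ Disjoint (Q.asIdeal : Set A) S := by
  have hdisj : Disjoint ((P.asIdeal ⊔ Ideal.span {x} : Ideal A) : Set A) S := by
    refine Set.disjoint_left.mpr fun s hs hsS ↦ ?_
    obtain ⟨p, hp, y, hy, rfl⟩ := Submodule.mem_sup.mp hs
    obtain ⟨a, rfl⟩ := Ideal.mem_span_singleton'.mp hy
    exact Set.disjoint_left.mp hP hp ⟨_, hsS, -a, 0, by ring⟩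
  obtain ⟨Q, hQ, hle, hQS⟩ := Ideal.exists_le_prime_disjoint _ _ hdisj
  have hxQ : x ∈ Q := hle (Ideal.mem_sup_right (Ideal.mem_span_singleton_self x))
  have hxP : x ∉ P.asIdeal := fun h ↦
    Set.disjoint_left.mp hP h ⟨1, S.one_mem, 0, 1, by ring⟩
  exact ⟨⟨Q, hQ⟩, lt_of_le_of_ne (le_sup_left.trans hle) (by rintro rfl; exact hxP hxQ), hQS⟩

theorem PrimeSpectrum.le_coheight_of_disjoint_lombardiSubmonoid {A : Type*} [CommRing A]
    {x : ℕ → A} {ℓ k : ℕ} {P : PrimeSpectrum A}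
    (hP : Disjoint (P.asIdeal : Set A) (lombardiSubmonoid x ℓ k)) :
    ((k + 1 : ℕ) : ℕ∞) ≤ Order.coheight P := by
  induction k generalizing P with
  | zero =>
    obtain ⟨Q, hPQ, -⟩ := exists_gt_disjoint_of_disjoint_lombardiStep hP
    simpa using (self_le_add_left 1 _).trans (Order.coheight_add_one_le hPQ)
  | succ k ih =>
    obtain ⟨Q, hPQ, hQ⟩ := exists_gt_disjoint_of_disjoint_lombardiStep hP
    rw [Nat.cast_succ]
    exact (add_le_add_left (ih hQ) 1).trans (Order.coheight_add_one_le hPQ)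

theorem lombardiChain_notMem {A : Type*} [CommRing A] {x : ℕ → A} {ℓ : ℕ}
    {P : ℕ → PrimeSpectrum A} (hle : ∀ i ≤ ℓ, P i ≤ P (i + 1))
    (hx : ∀ i ≤ ℓ, x i ∈ (P (i + 1)).asIdeal) (hx' : ∀ i ≤ ℓ, x i ∉ (P i).asIdeal)
    (a : ℕ → A) (m : ℕ → ℕ) {k : ℕ} (hk : k ≤ ℓ) :
    lombardiChain x a m ℓ k ∉ (P (ℓ - k)).asIdeal := by
  have step {i : ℕ} (hi : i ≤ ℓ) {s : A} (hs : s ∉ (P (i + 1)).asIdeal) :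
      x i ^ m i * (s + a i * x i) ∉ (P i).asIdeal := by
    intro h
    rcases (P i).isPrime.mem_or_mem h with h | h
    · exact hx' i hi ((P i).isPrime.mem_of_pow_mem _ h)
    · exact hs ((Ideal.add_mem_iff_left _ (Ideal.mul_mem_left _ _ (hx i hi))).mp (hle i hi h))
  induction k with
  | zero => exact step le_rfl fun h ↦ (P (ℓ + 1)).isPrime.ne_top ((Ideal.eq_top_iff_one _).mpr h)
  | succ k ih =>
    refine step (Nat.sub_le _ _) ?_
    rw [show ℓ - (k + 1) + 1 = ℓ - k by omega]
    exact ih (by omega)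

/-- Corollary 4.4.5 ((1) ↔ (3)): Lombardi's algebraic identity characterization
of Krull dimension. -/
theorem ringKrullDim_le_iff_algebraic_identity (A : Type*) [CommRing A] (ℓ : ℕ) :
    ringKrullDim A ≤ (ℓ : WithBot ℕ∞) ↔
      ∀ x : ℕ → A, ∃ a : ℕ → A, ∃ m : ℕ → ℕ, lombardiChain x a m ℓ ℓ = 0 := by
  constructor
  · intro h x
    refine exists_lombardiChain_eq le_rfl ?_
    by_contra h0
    have hdisj : Disjoint ((⊥ : Ideal A) : Set A) (lombardiSubmonoid x ℓ ℓ) := by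
      simpa [Set.disjoint_left] using h0
    obtain ⟨P, hP, -, hPS⟩ := Ideal.exists_le_prime_disjoint _ _ hdisj
    have hle := PrimeSpectrum.le_coheight_of_disjoint_lombardiSubmonoid (P := ⟨P, hP⟩) hPS
    have hlt := ((WithBot.coe_le_coe.mpr hle).trans (Order.coheight_le_krullDim _)).trans h
    have : ℓ + 1 ≤ ℓ := by exact_mod_cast hlt
    omega
  · intro h
    by_contra hlt
    have hdim : ((ℓ + 1 : ℕ) : WithBot ℕ∞) ≤ Order.krullDim (PrimeSpectrum A) := by
      by_contra hn
      rw [not_le, Order.krullDim_lt_coe_iff] at hn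
      exact hlt (iSup_le fun p ↦ by exact_mod_cast Nat.lt_succ_iff.mp (hn p))
    obtain ⟨p, hp⟩ := Order.le_krullDim_iff.mp hdim
    let P : ℕ → PrimeSpectrum A := fun i ↦ p (Fin.ofNat _ i)
    have hP : ∀ i ≤ ℓ, P i < P (i + 1) := fun i hi ↦ p.strictMono <| by
      rw [Fin.lt_def, Fin.val_ofNat, Fin.val_ofNat, Nat.mod_eq_of_lt (by omega),
        Nat.mod_eq_of_lt (by omega)]
      omega
    have hex : ∀ i, ∃ y, i ≤ ℓ → y ∈ (P (i + 1)).asIdeal ∧ y ∉ (P i).asIdeal := fun i ↦ by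
      by_cases hi : i ≤ ℓ
      · obtain ⟨y, hy⟩ :=
          SetLike.exists_of_lt (show (P i).asIdeal < (P (i + 1)).asIdeal from hP i hi)
        exact ⟨y, fun _ ↦ hy⟩
      · exact ⟨0, fun h ↦ absurd h hi⟩
    choose x hx using hex
    obtain ⟨a, m, h0⟩ := h x
    refine lombardiChain_notMem (fun i hi ↦ (hP i hi).le) (fun i hi ↦ (hx i hi).1)
      (fun i hi ↦ (hx i hi).2) a m le_rfl (?_ : lombardiChain x a m ℓ ℓ ∈ _)
    rw [h0]
    exact Ideal.zero_mem _
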